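/- Let n ≥ 3 and 1 ≤ d < n. There exists a constant C > 0 depending only on n such that the following holds. Let Ω ⊂ ℝⁿ be open, let ψ : Ω → ℝ be a C² convex function with ψ ≥ 0 on Ω and det D²ψ(x) ≥ 1/λ² for all x ∈ Ω (λ > 0), and suppose ψ(x₀) = 0 for some x₀ ∈ Ω with δ := dist(x₀, ∂Ω) > 0. Let L := sup_{x ∈ Ω} |∇ψ(x)|, assumed finite and positive, and let H be a d-dimensional affine subspace of ℝⁿ containing x₀. Then for every ℓ with 0 < ℓ ≤ δ/2, the quantity γ := ( sup_{x ∈ B_ℓ(x₀) ∩ H} ψ(x) ) / L satisfies γ > 0 and ℓ^{2d} · φ(δ/γ) ≤ C λ² Lⁿ δ^{2d−n}, where φ(s) := s^{2d−n} ∫₀^s r^{n−d−1} / (r+1)^d dr. -/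

import Mathlib

open MeasureTheory Set Metric Filter
open scoped RealInnerProductSpace ENNReal

noncomputable section

abbrev E (n : ℕ) := EuclideanSpace ℝ (Fin n)

/-- The determinant of the Hessian matrix `D²ψ(x)`. -/
def hessDet {n : ℕ} (ψ : E n → ℝ) (x : E n) : ℝ :=
  Matrix.det (Matrix.of fun i j : Fin n =>
    iteratedFDeriv ℝ 2 ψ x ![EuclideanSpace.single i 1, EuclideanSpace.single j 1])

lemma psd_sqrt {m : Type*} [Fintype m] [DecidableEq m] (P : Matrix m m ℝ) (hP : P.PosSemidef) :
    ∃ R : Matrix m m ℝ, P = R.conjTranspose * R := by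
  open scoped MatrixOrder in
  obtain ⟨R, hR⟩ := CStarAlgebra.nonneg_iff_eq_star_mul_self.1 hP.nonneg
  exact ⟨R, hR⟩

lemma det_one_add_ge {m : Type*} [Fintype m] [DecidableEq m] (Q : Matrix m m ℝ)
    (hQ : Q.PosSemidef) : 1 ≤ (1 + Q).det := by
  have h := hQ.1.spectral_theorem
  set U := hQ.1.eigenvectorUnitary
  have h2 : 1 + Q = (U : Matrix m m ℝ) * (1 + Matrix.diagonal hQ.1.eigenvalues) * (star U : Matrix m m ℝ) := by
    rw [mul_add, add_mul, mul_one]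
    have : (U : Matrix m m ℝ) * (star U : Matrix m m ℝ) = 1 := by simp
    rw [this]
    congr 1
  rw [h2, Matrix.det_mul_right_comm]
  have : (U : Matrix m m ℝ) * (star U : Matrix m m ℝ) = 1 := by simp
  rw [this, one_mul, ← Matrix.diagonal_one, Matrix.diagonal_add, Matrix.det_diagonal]
  calc (1:ℝ) = ∏ i : m, (1:ℝ) := by simp
    _ ≤ _ := by
      apply Finset.prod_le_prod
      · intro i _; norm_num
      · intro i _
        have := hQ.eigenvalues_nonneg i
        simpa using this

lemma det_le_det_add {m : Type*} [Fintype m] [DecidableEq m] (P Q : Matrix m m ℝ)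
    (hP : P.PosSemidef) (hQ : Q.PosSemidef) : P.det ≤ (P + Q).det := by
  by_cases h0 : P.det = 0
  · rw [h0]; exact (hP.add hQ).det_nonneg
  · obtain ⟨R, hR⟩ := psd_sqrt P hP
    have hRd : IsUnit R.det := by
      rw [isUnit_iff_ne_zero]; intro h; apply h0; rw [hR, Matrix.det_mul, h, mul_zero]
    have e : P + Q = R.conjTranspose * (1 + (R⁻¹).conjTranspose * Q * R⁻¹) * R := by
      rw [mul_add, add_mul, mul_one, ← hR]
      congr 1
      have h1 : R⁻¹ * R = 1 := Matrix.nonsing_inv_mul _ hRd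
      have h2 : R.conjTranspose * (R⁻¹).conjTranspose = 1 := by
        rw [← Matrix.conjTranspose_mul, h1, Matrix.conjTranspose_one]
      calc Q = (R.conjTranspose * (R⁻¹).conjTranspose) * Q * (R⁻¹ * R) := by rw [h1, h2]; simp
        _ = _ := by simp only [Matrix.mul_assoc]
    have h1 := det_one_add_ge _ (hQ.conjTranspose_mul_mul_same R⁻¹)
    have e2 : (P+Q).det = P.det * (1 + (R⁻¹).conjTranspose * Q * R⁻¹).det := by
      rw [e, hR]; simp only [Matrix.det_mul]; ring
    rw [e2]
    exact le_mul_of_one_le_right hP.det_nonneg h1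

lemma fischer {p q : Type*} [Fintype p] [DecidableEq p] [Fintype q] [DecidableEq q]
    (M : Matrix (p ⊕ q) (p ⊕ q) ℝ) (hM : M.PosDef) :
    M.det ≤ M.toBlocks₁₁.det * M.toBlocks₂₂.det := by
  have hA : M.toBlocks₁₁.PosDef := hM.submatrix Sum.inl_injective
  have hu := hA.isUnit
  have hinv : Invertible M.toBlocks₁₁ := hu.invertible
  have hH : M.toBlocks₂₁ = M.toBlocks₁₂.conjTranspose := by
    ext i j
    exact (hM.1.apply (Sum.inr i) (Sum.inl j)).symm
  have hMe : M = Matrix.fromBlocks M.toBlocks₁₁ M.toBlocks₁₂ M.toBlocks₁₂.conjTranspose M.toBlocks₂₂ := by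
    rw [← hH, Matrix.fromBlocks_toBlocks]
  have hS : (M.toBlocks₂₂ - M.toBlocks₁₂.conjTranspose * M.toBlocks₁₁⁻¹ * M.toBlocks₁₂).PosSemidef := by
    rw [← Matrix.PosDef.fromBlocks₁₁ _ _ hA, ← hMe]; exact hM.posSemidef
  have hd : M.det = M.toBlocks₁₁.det * (M.toBlocks₂₂ - M.toBlocks₁₂.conjTranspose * M.toBlocks₁₁⁻¹ * M.toBlocks₁₂).det := by
    conv_lhs => rw [hMe]
    rw [Matrix.det_fromBlocks₁₁, Matrix.invOf_eq_nonsing_inv]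
  rw [hd]
  apply mul_le_mul_of_nonneg_left _ hA.det_pos.le
  have := det_le_det_add _ _ hS (hA.inv.posSemidef.conjTranspose_mul_mul_same M.toBlocks₁₂)
  simpa using this

lemma inner_matrix {m : ℕ} (T : E m →L[ℝ] E m) (i j : Fin m) :
    LinearMap.toMatrix (EuclideanSpace.basisFun (Fin m) ℝ).toBasis
      (EuclideanSpace.basisFun (Fin m) ℝ).toBasis (T : E m →ₗ[ℝ] E m) i j
     = ⟪EuclideanSpace.single i 1, T (EuclideanSpace.single j 1)⟫ := by
  simp [LinearMap.toMatrix_apply, EuclideanSpace.inner_single_left]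

lemma posDef_of_symm {ι : Type*} [Fintype ι] [DecidableEq ι] {n : ℕ} (T : E n →L[ℝ] E n)
    (hs : ∀ u v, ⟪T u, v⟫ = ⟪u, T v⟫) (hp : ∀ v, v ≠ 0 → 0 < ⟪T v, v⟫)
    (b : OrthonormalBasis ι ℝ (E n)) :
    (Matrix.of fun i j => ⟪b i, T (b j)⟫).PosDef := by
  apply Matrix.PosDef.of_dotProduct_mulVec_pos
  · ext i j
    change ⟪b j, T (b i)⟫ = ⟪b i, T (b j)⟫
    rw [← hs, real_inner_comm]
  · intro x hx
    have hv : (∑ i, x i • b i) ≠ 0 := by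
      intro h
      apply hx
      have := (Fintype.linearIndependent_iff.1 b.toBasis.linearIndependent) x (by simpa using h)
      ext i; exact this i
    have h := hp _ hv
    rw [real_inner_comm] at h
    have e : dotProduct (star x) ((Matrix.of fun i j => ⟪b i, T (b j)⟫).mulVec x)
        = ⟪∑ i, x i • b i, T (∑ i, x i • b i)⟫ := by
      simp only [dotProduct, Matrix.mulVec, map_sum, map_smul, sum_inner, inner_sum, inner_smul_left,
        inner_smul_right, Matrix.of_apply, Finset.mul_sum]
      rw [Finset.sum_comm]
      refine Finset.sum_congr rfl fun i _ => Finset.sum_congr rfl fun j _ => ?_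
      simp only [Pi.star_apply, star_trivial, conj_trivial]; ring
    rw [e]; exact h

lemma fischer_geom {n d k : ℕ} (hn : d + k = n) (hd : 1 ≤ d) (T : E n →L[ℝ] E n)
    (hs : ∀ u v, ⟪T u, v⟫ = ⟪u, T v⟫) (hp : ∀ v, v ≠ 0 → 0 < ⟪T v, v⟫)
    (J : E d →ₗᵢ[ℝ] E n) (K : E k →ₗᵢ[ℝ] E n) (hJK : ∀ y z, ⟪J y, K z⟫ = 0) :
    T.det ≤ (((J.toContinuousLinearMap).adjoint ∘L T ∘L J.toContinuousLinearMap).det) *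
     (((K.toContinuousLinearMap).adjoint ∘L T ∘L K.toContinuousLinearMap).det) := by
  let v : Fin d ⊕ Fin k → E n := Sum.elim (fun i => J (EuclideanSpace.single i 1))
    (fun i => K (EuclideanSpace.single i 1))
  have hv : Orthonormal ℝ v := by
    rw [orthonormal_iff_ite]
    rintro (i|i) (j|j)
    · simp [v, J.inner_map_map, EuclideanSpace.inner_single_left]
    · simp [v, hJK]
    · simp [v, real_inner_comm, hJK]
    · simp [v, K.inner_map_map, EuclideanSpace.inner_single_left]
  have : Nonempty (Fin d ⊕ Fin k) := ⟨Sum.inl ⟨0, hd⟩⟩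
  let b0 := basisOfOrthonormalOfCardEqFinrank hv (by simp [hn])
  have hb0 : (b0 : _ → E n) = v := coe_basisOfOrthonormalOfCardEqFinrank hv _
  let b := b0.toOrthonormalBasis (by rw [hb0]; exact hv)
  have hb : ∀ i, b i = v i := by intro i; simp [b, hb0]
  have hM := fischer _ (posDef_of_symm T hs hp b)
  have e0 : T.det = (Matrix.of fun i j => ⟪b i, T (b j)⟫).det := by
    change LinearMap.det (T : E n →ₗ[ℝ] E n) = _
    rw [← LinearMap.det_toMatrix b.toBasis]
    congr 1
    ext i j
    simp [LinearMap.toMatrix_apply, b.repr_apply_apply]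
  have e1 : ((J.toContinuousLinearMap).adjoint ∘L T ∘L J.toContinuousLinearMap).det =
      (Matrix.of fun i j => ⟪b i, T (b j)⟫).toBlocks₁₁.det := by
    change LinearMap.det (_ : E d →ₗ[ℝ] E d) = _
    rw [← LinearMap.det_toMatrix (EuclideanSpace.basisFun (Fin d) ℝ).toBasis]
    congr 1
    ext i j
    rw [inner_matrix]
    simp only [ContinuousLinearMap.comp_apply, ContinuousLinearMap.adjoint_inner_right]
    simp [Matrix.toBlocks₁₁, hb, v]
  have e2 : ((K.toContinuousLinearMap).adjoint ∘L T ∘L K.toContinuousLinearMap).det =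
      (Matrix.of fun i j => ⟪b i, T (b j)⟫).toBlocks₂₂.det := by
    change LinearMap.det (_ : E k →ₗ[ℝ] E k) = _
    rw [← LinearMap.det_toMatrix (EuclideanSpace.basisFun (Fin k) ℝ).toBasis]
    congr 1
    ext i j
    rw [inner_matrix]
    simp only [ContinuousLinearMap.comp_apply, ContinuousLinearMap.adjoint_inner_right]
    simp [Matrix.toBlocks₂₂, hb, v]
  rw [e0, e1, e2]
  exact hM

lemma ball_sub_omega {n : ℕ} {Ω : Set (E n)} {x₀ : E n} (hx : x₀ ∈ Ω) {δ : ℝ}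
    (hδ : δ = infDist x₀ (frontier Ω)) : ball x₀ δ ⊆ Ω := by
  intro y hy
  by_contra hc
  have hne : Ω ≠ univ := fun h => hc (h ▸ mem_univ y)
  obtain ⟨w, hw, hwd⟩ := exists_mem_frontier_infDist_compl_eq_dist hx hne
  have h1 : infDist x₀ Ωᶜ ≤ dist x₀ y := infDist_le_dist_of_mem hc
  have h2 : infDist x₀ (frontier Ω) ≤ dist x₀ w := infDist_le_dist_of_mem hw
  rw [mem_ball, dist_comm] at hy
  linarith

lemma grad_ineq {n : ℕ} {Ω : Set (E n)} {ψ : E n → ℝ}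
    (hc : ConvexOn ℝ Ω ψ) {x y : E n} (hx : x ∈ Ω) (hy : y ∈ Ω)
    (hd : DifferentiableAt ℝ ψ x) : ψ x + ⟪gradient ψ x, y - x⟫ ≤ ψ y := by
  have hg : HasDerivAt (fun t : ℝ => ψ (x + t • (y - x))) ⟪gradient ψ x, y - x⟫ 0 := by
    have h1 : HasDerivAt (fun t : ℝ => x + t • (y - x)) (y - x) 0 := by
      simpa using ((hasDerivAt_id (0:ℝ)).smul_const (y - x)).const_add x
    have h2 : HasFDerivAt ψ (fderiv ℝ ψ x) (x + (0:ℝ) • (y - x)) := by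
      simpa using hd.hasFDerivAt
    have := h2.comp_hasDerivAt (0:ℝ) h1
    have e : ⟪gradient ψ x, y - x⟫ = fderiv ℝ ψ x (y - x) := by
      simp [gradient]
    rw [e]; exact this
  have hcv : ConvexOn ℝ (Icc (0:ℝ) 1) (fun t : ℝ => ψ (x + t • (y - x))) := by
    refine ⟨convex_Icc _ _, ?_⟩
    intro s hs t ht a b ha hb hab
    have mem : ∀ r ∈ Icc (0:ℝ) 1, x + r • (y - x) ∈ Ω := fun r hr =>
      hc.1.add_smul_sub_mem hx hy hr
    have := hc.2 (mem s hs) (mem t ht) ha hb hab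
    have e : x + (a • s + b • t) • (y - x) = a • (x + s • (y - x)) + b • (x + t • (y - x)) := by
      have : x = (a + b) • x := by rw [hab, one_smul]
      conv_lhs => rw [this]
      simp only [smul_eq_mul]
      rw [hab]
      nth_rewrite 1 [this]
      module
    simp only [e]; exact this
  have := hcv.le_slope_of_hasDerivAt (x := 0) (y := 1) (by simp) (by simp) (by norm_num) hg
  simp only [slope, sub_zero, inv_one, one_smul, zero_smul, add_zero, add_sub_cancel, vsub_eq_sub] at this
  linarith

lemma grad_mono {n : ℕ} {Ω : Set (E n)} {ψ : E n → ℝ}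
    (hc : ConvexOn ℝ Ω ψ) {x y : E n} (hx : x ∈ Ω) (hy : y ∈ Ω)
    (hd : DifferentiableAt ℝ ψ x) (hd' : DifferentiableAt ℝ ψ y) :
    0 ≤ ⟪gradient ψ y - gradient ψ x, y - x⟫ := by
  have h1 := grad_ineq hc hx hy hd
  have h2 := grad_ineq hc hy hx hd'
  have : x - y = -(y - x) := by abel
  rw [this, inner_neg_right] at h2
  rw [inner_sub_left]; linarith

lemma grad_diff {n : ℕ} {ψ : E n → ℝ} {x : E n} (h : ContDiffAt ℝ 2 ψ x) :
    DifferentiableAt ℝ (gradient ψ) x := by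
  have h1 : DifferentiableAt ℝ (fderiv ℝ ψ) x :=
    (h.fderiv_right (m := 1) (by norm_num)).differentiableAt (by norm_num)
  exact ((InnerProductSpace.toDual ℝ (E n)).symm.toContinuousLinearEquiv.differentiableAt).comp x h1

lemma grad_fderiv {n : ℕ} {ψ : E n → ℝ} {x : E n} (h : ContDiffAt ℝ 2 ψ x) (v w : E n) :
    ⟪fderiv ℝ (gradient ψ) x v, w⟫ = fderiv ℝ (fderiv ℝ ψ) x v w := by
  have h1 : DifferentiableAt ℝ (fderiv ℝ ψ) x :=
    (h.fderiv_right (m := 1) (by norm_num)).differentiableAt (by norm_num)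
  have h2 := (grad_diff h).hasFDerivAt.inner ℝ (hasFDerivAt_const w x)
  have h3 := h1.hasFDerivAt.clm_apply (hasFDerivAt_const w x)
  have e : (fun y => ⟪gradient ψ y, w⟫) = fun y => fderiv ℝ ψ y w := by
    ext y; simp [gradient]
  rw [e] at h2
  have h4 := congrArg (fun T : E n →L[ℝ] ℝ => T v) (h2.unique h3)
  simpa using h4

lemma hess_symm {n : ℕ} {ψ : E n → ℝ} {x : E n} (h : ContDiffAt ℝ 2 ψ x) (v w : E n) :
    ⟪fderiv ℝ (gradient ψ) x v, w⟫ = ⟪v, fderiv ℝ (gradient ψ) x w⟫ := by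
  rw [real_inner_comm _ v, grad_fderiv h, grad_fderiv h]
  exact (h.isSymmSndFDerivAt (by simp)).eq v w

lemma hess_det {n : ℕ} {ψ : E n → ℝ} {x : E n} (h : ContDiffAt ℝ 2 ψ x) :
    hessDet ψ x = (fderiv ℝ (gradient ψ) x).det := by
  change _ = LinearMap.det (_ : E n →ₗ[ℝ] E n)
  rw [← LinearMap.det_toMatrix (EuclideanSpace.basisFun (Fin n) ℝ).toBasis]
  unfold hessDet
  congr 1
  ext i j
  rw [inner_matrix, ← hess_symm h, grad_fderiv h, Matrix.of_apply, iteratedFDeriv_two_apply]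
  simp

lemma hess_nonneg {n : ℕ} {Ω : Set (E n)} (hΩ : IsOpen Ω) {ψ : E n → ℝ}
    (hc : ConvexOn ℝ Ω ψ) (hψ : ContDiffOn ℝ 2 ψ Ω) {x : E n} (hx : x ∈ Ω) (v : E n) :
    0 ≤ ⟪fderiv ℝ (gradient ψ) x v, v⟫ := by
  have hca : ∀ y ∈ Ω, ContDiffAt ℝ 2 ψ y := fun y hy => hψ.contDiffAt (hΩ.mem_nhds hy)
  have hg := (grad_diff (hca x hx)).hasFDerivAt
  have h1 : HasDerivAt (fun t : ℝ => x + t • v) v 0 := by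
    simpa using ((hasDerivAt_id (0:ℝ)).smul_const v).const_add x
  have h2 : HasDerivAt (fun t : ℝ => gradient ψ (x + t • v)) (fderiv ℝ (gradient ψ) x v) 0 := by
    have h2 : HasFDerivAt (gradient ψ) (fderiv ℝ (gradient ψ) x) (x + (0:ℝ) • v) := by
      simpa using hg
    exact h2.comp_hasDerivAt (0:ℝ) h1
  have h3 : HasDerivAt (fun t : ℝ => ⟪gradient ψ (x + t • v), v⟫) ⟪fderiv ℝ (gradient ψ) x v, v⟫ 0 := by
    simpa using h2.inner ℝ (hasDerivAt_const (0:ℝ) v)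
  have h4 := h3.tendsto_slope_zero_right
  refine ge_of_tendsto h4 ?_
  have h5 : ∀ᶠ t : ℝ in nhds 0, x + t • v ∈ Ω := by
    apply h1.continuousAt.eventually_mem
    simpa using hΩ.mem_nhds hx
  filter_upwards [nhdsWithin_le_nhds h5, self_mem_nhdsWithin] with t ht ht0
  have ht0 : 0 < t := ht0
  have := grad_mono hc hx ht ((hca x hx).differentiableAt (by norm_num))
    ((hca _ ht).differentiableAt (by norm_num))
  simp only [add_sub_cancel_left, inner_smul_right, inner_sub_left] at this
  have h6 := nonneg_of_mul_nonneg_right this ht0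
  simp only [zero_add, zero_smul, add_zero, smul_eq_mul]
  exact mul_nonneg (by positivity) h6

lemma pos_of_nonneg {n : ℕ} (T : E n →L[ℝ] E n)
    (hs : ∀ u v, ⟪T u, v⟫ = ⟪u, T v⟫) (hp : ∀ v, 0 ≤ ⟪T v, v⟫) (hdet : 0 < T.det) :
    ∀ v, v ≠ 0 → 0 < ⟪T v, v⟫ := by
  intro v hv
  refine lt_of_le_of_ne (hp v) fun h0 => ?_
  -- quadratic trick
  have hq : ∀ w, ⟪T v, w⟫ = 0 := by
    intro w
    by_contra hne
    have key : ∀ t : ℝ, 0 ≤ 2 * t * ⟪T v, w⟫ + t ^ 2 * ⟪T w, w⟫ := by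
      intro t
      have := hp (v + t • w)
      simp only [map_add, map_smul, inner_add_left, inner_add_right, inner_smul_left,
        inner_smul_right] at this
      have e : ⟪T w, v⟫ = ⟪T v, w⟫ := by rw [hs, real_inner_comm]
      rw [e, ← h0] at this
      simp at this
      nlinarith
    have hw := hp w
    have := key (-(⟪T v, w⟫ / (⟪T w, w⟫ + 1)))
    have hpos : 0 < ⟪T w, w⟫ + 1 := by linarith
    have e : 2 * (-(⟪T v, w⟫ / (⟪T w, w⟫ + 1))) * ⟪T v, w⟫ + (-(⟪T v, w⟫ / (⟪T w, w⟫ + 1))) ^ 2 * ⟪T w, w⟫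
      = - (⟪T v, w⟫ ^ 2 * (⟪T w, w⟫ + 2)) / (⟪T w, w⟫ + 1)^2 := by
      field_simp; ring
    rw [e] at this
    have : 0 < (⟪T v, w⟫ ^ 2 * (⟪T w, w⟫ + 2)) / (⟪T w, w⟫ + 1)^2 := by positivity
    rw [neg_div] at *
    linarith
  have hTv : T v = 0 := by
    have := hq (T v); simpa using this
  have hinj : LinearMap.ker (T : E n →ₗ[ℝ] E n) = ⊥ := by
    have : IsUnit (LinearMap.det (T : E n →ₗ[ℝ] E n)) := isUnit_iff_ne_zero.2 hdet.ne'
    exact (LinearMap.isUnit_iff_ker_eq_bot _).1 ((LinearMap.isUnit_iff_isUnit_det _).2 this)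
  exact hv (LinearMap.ker_eq_bot'.1 hinj v hTv)

lemma slice_hasFDeriv {n m : ℕ} {G : E n → E n} (J : E m →ₗᵢ[ℝ] E n) (c : E n) {y : E m}
    (hG : DifferentiableAt ℝ G (c + J y)) :
    HasFDerivAt (fun y => J.toContinuousLinearMap.adjoint (G (c + J y)))
      (J.toContinuousLinearMap.adjoint ∘L fderiv ℝ G (c + J y) ∘L J.toContinuousLinearMap) y := by
  have h1 : HasFDerivAt (fun y => c + J y) J.toContinuousLinearMap y :=
    (J.toContinuousLinearMap.hasFDerivAt).const_add c
  have h2 := hG.hasFDerivAt.comp y h1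
  exact (J.toContinuousLinearMap.adjoint.hasFDerivAt).comp y h2

lemma slice_inj {n m : ℕ} {Ω : Set (E n)} {G : E n → E n}
    (hG : ∀ x ∈ Ω, DifferentiableAt ℝ G x)
    (hpos : ∀ x ∈ Ω, ∀ v, v ≠ 0 → 0 < ⟪fderiv ℝ G x v, v⟫)
    (J : E m →ₗᵢ[ℝ] E n) (c : E n) {s : Set (E m)} (hs : Convex ℝ s)
    (hsΩ : ∀ y ∈ s, c + J y ∈ Ω) :
    InjOn (fun y => J.toContinuousLinearMap.adjoint (G (c + J y))) s := by
  intro y1 h1 y2 h2 heq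
  by_contra hne
  have hv : y2 - y1 ≠ 0 := sub_ne_zero.2 (Ne.symm hne)
  set v := y2 - y1 with hvdef
  have mem : ∀ t ∈ Icc (0:ℝ) 1, y1 + t • v ∈ s := fun t ht => hs.add_smul_sub_mem h1 h2 ht
  have hder : ∀ t ∈ Icc (0:ℝ) 1, HasDerivAt (fun t : ℝ =>
      ⟪J.toContinuousLinearMap.adjoint (G (c + J (y1 + t • v))), v⟫)
      ⟪fderiv ℝ G (c + J (y1 + t • v)) (J v), J v⟫ t := by
    intro t ht
    have a1 : HasDerivAt (fun t : ℝ => y1 + t • v) v t := by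
      simpa using ((hasDerivAt_id t).smul_const v).const_add y1
    have a2 := (slice_hasFDeriv J c (hG _ (hsΩ _ (mem t ht)))).comp_hasDerivAt t a1
    have a3 := a2.inner ℝ (hasDerivAt_const t v)
    simp only [inner_zero_right, zero_add, ContinuousLinearMap.comp_apply,
      ContinuousLinearMap.adjoint_inner_left] at a3
    simpa [ContinuousLinearMap.adjoint_inner_left] using a3
  have hmono := strictMonoOn_of_deriv_pos (convex_Icc (0:ℝ) 1)
    (fun t ht => (hder t ht).continuousAt.continuousWithinAt) (by
      intro t ht
      rw [interior_Icc] at ht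
      have ht' : t ∈ Icc (0:ℝ) 1 := ⟨ht.1.le, ht.2.le⟩
      rw [(hder t ht').deriv]
      apply hpos _ (hsΩ _ (mem t ht'))
      intro h0
      exact hv (J.injective (by rw [h0, map_zero])))
  have := hmono (a := 0) (b := 1) (by simp) (by simp) (by norm_num)
  simp only [zero_smul, add_zero, one_smul] at this
  have e : y1 + v = y2 := by simp [hvdef]
  rw [e] at this
  simp only at heq
  rw [heq] at this
  exact lt_irrefl _ this

lemma slice_bound {n m : ℕ} {Ω : Set (E n)} {G : E n → E n}
    (hG : ∀ x ∈ Ω, DifferentiableAt ℝ G x)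
    (hpos : ∀ x ∈ Ω, ∀ v, v ≠ 0 → 0 < ⟪fderiv ℝ G x v, v⟫)
    (J : E m →ₗᵢ[ℝ] E n) (c : E n) (ρ R : ℝ) (hR : 0 ≤ R)
    (hsΩ : ∀ y ∈ ball (0 : E m) ρ, c + J y ∈ Ω)
    (hb : ∀ y ∈ ball (0 : E m) ρ, ‖J.toContinuousLinearMap.adjoint (G (c + J y))‖ ≤ R) :
    ∫⁻ y in ball (0 : E m) ρ, ENNReal.ofReal
      |(J.toContinuousLinearMap.adjoint ∘L fderiv ℝ G (c + J y) ∘L J.toContinuousLinearMap).det|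
      ≤ ENNReal.ofReal (R ^ m) * volume (ball (0 : E m) 1) := by
  rw [lintegral_abs_det_fderiv_eq_addHaar_image volume measurableSet_ball
    (fun y hy => (slice_hasFDeriv J c (hG _ (hsΩ y hy))).hasFDerivWithinAt)
    (slice_inj hG hpos J c (convex_ball _ _) hsΩ)]
  calc _ ≤ volume (closedBall (0 : E m) R) := by
        apply measure_mono
        rintro _ ⟨y, hy, rfl⟩
        simpa using hb y hy
    _ = _ := by
      rw [Measure.addHaar_closedBall _ _ hR]; simp

lemma measure_est {d k : ℕ} (a b : E d → E k → ℝ) 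
    (hbm : Measurable (Function.uncurry b))
    (ha0 : ∀ y z, 0 ≤ a y z) (hb0 : ∀ y z, 0 ≤ b y z)
    (lam M L γ ρ r : ℝ) (hlam : 0 < lam) (hM : 0 < M) (hγ : 0 < γ) (hρ : 0 < ρ) (hL : 0 < L)
    (ha : ∀ z ∈ ball (0 : E k) r, ∫⁻ y in ball (0 : E d) ρ, ENNReal.ofReal (a y z) ≤
      ENNReal.ofReal ((M * (γ + ‖z‖)) ^ d) * volume (ball (0 : E d) 1))
    (hb : ∀ y ∈ ball (0 : E d) ρ, ∫⁻ z in ball (0 : E k) r, ENNReal.ofReal (b y z) ≤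
      ENNReal.ofReal (L ^ k) * volume (ball (0 : E k) 1))
    (hab : ∀ y ∈ ball (0 : E d) ρ, ∀ z ∈ ball (0 : E k) r, 1 / lam ^ 2 ≤ a y z * b y z) :
    ∫⁻ z in ball (0 : E k) r, ENNReal.ofReal (1 / (γ + ‖z‖) ^ d) ≤
      ENNReal.ofReal (lam ^ 2 * (M / ρ) ^ d * L ^ k) * volume (ball (0 : E k) 1) := by
  set ωd := volume (ball (0 : E d) 1) with hωd
  set ωk := volume (ball (0 : E k) 1) with hωk
  have hωd0 : ωd ≠ 0 := (measure_ball_pos _ _ one_pos).ne'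
  have hωdt : ωd ≠ ⊤ := measure_ball_lt_top.ne
  have hvol : volume (ball (0 : E d) ρ) = ENNReal.ofReal (ρ ^ d) * ωd := by
    rw [Measure.addHaar_ball_of_pos _ _ hρ]; simp [hωd]
  have hbm' : Measurable (fun p : E k × E d => ENNReal.ofReal (b p.2 p.1)) :=
    (hbm.comp measurable_swap).ennreal_ofReal
  -- pointwise in z
  have hz : ∀ z ∈ ball (0 : E k) r, ENNReal.ofReal (1 / (γ + ‖z‖) ^ d) *
      (ENNReal.ofReal (ρ ^ d / lam) * ωd) ≤
      ENNReal.ofReal (lam * M ^ d / ρ ^ d) * ∫⁻ y in ball (0 : E d) ρ, ENNReal.ofReal (b y z) := by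
    intro z hz
    have hgz : 0 < γ + ‖z‖ := by positivity
    set w := 1 / (γ + ‖z‖) ^ d with hw
    have hw0 : 0 < w := by positivity
    set s := ρ ^ d / (lam * M ^ d) with hsdef
    have hs0 : 0 < s := by positivity
    have pt : ∀ y ∈ ball (0 : E d) ρ, ENNReal.ofReal (2 * w / lam) ≤
        ENNReal.ofReal (s * w ^ 2) * ENNReal.ofReal (a y z)
         + ENNReal.ofReal (1 / s) * ENNReal.ofReal (b y z) := by
      intro y hy
      rw [← ENNReal.ofReal_mul (by positivity), ← ENNReal.ofReal_mul (by positivity),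
        ← ENNReal.ofReal_add (mul_nonneg (by positivity) (ha0 _ _))
          (mul_nonneg (by positivity) (hb0 _ _))]
      apply ENNReal.ofReal_le_ofReal
      have h := hab y hy z hz
      have h1 : (2 * w / lam) ^ 2 ≤ (s * w ^ 2 * a y z + 1 / s * b y z) ^ 2 := by
        have e1 : (2 * w / lam) ^ 2 = 4 * w ^ 2 * (1 / lam ^ 2) := by field_simp; norm_num
        have e2 : 4 * w ^ 2 * (a y z * b y z) = 4 * (s * w ^ 2 * a y z) * (1 / s * b y z) := by
          field_simp
        have e3 := mul_le_mul_of_nonneg_left h (by positivity : 0 ≤ 4 * w ^ 2)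
        rw [e1]
        rw [e2] at e3
        nlinarith [sq_nonneg (s * w ^ 2 * a y z - 1 / s * b y z)]
      refine le_of_sq_le_sq h1 ?_
      have := ha0 y z
      have := hb0 y z
      positivity
    have h2 := setLIntegral_mono' (μ := volume) measurableSet_ball pt
    rw [lintegral_add_right _ (by
        exact ((hbm'.comp (measurable_const.prodMk measurable_id)).const_mul _)),
      setLIntegral_const, lintegral_const_mul' _ _ ENNReal.ofReal_ne_top,
      lintegral_const_mul' _ _ ENNReal.ofReal_ne_top, hvol] at h2
    have h3 := ha z hz
    have h4 : ENNReal.ofReal (s * w ^ 2) * ∫⁻ y in ball (0 : E d) ρ, ENNReal.ofReal (a y z) ≤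
        ENNReal.ofReal w * (ENNReal.ofReal (ρ ^ d / lam) * ωd) := by
      calc _ ≤ ENNReal.ofReal (s * w ^ 2) * (ENNReal.ofReal ((M * (γ + ‖z‖)) ^ d) * ωd) := by gcongr
        _ = _ := by
          rw [← mul_assoc, ← mul_assoc, ← ENNReal.ofReal_mul (by positivity),
            ← ENNReal.ofReal_mul (by positivity)]
          congr 2
          rw [hsdef, hw, mul_pow]; field_simp
    have h5 : ENNReal.ofReal (2 * w / lam) * (ENNReal.ofReal (ρ ^ d) * ωd) =
        ENNReal.ofReal w * (ENNReal.ofReal (ρ ^ d / lam) * ωd) +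
        ENNReal.ofReal w * (ENNReal.ofReal (ρ ^ d / lam) * ωd) := by
      rw [← two_mul, ← mul_assoc, ← mul_assoc, ← mul_assoc, ← ENNReal.ofReal_mul (by positivity)]
      have : (2 : ℝ≥0∞) = ENNReal.ofReal 2 := by simp
      rw [this, ← ENNReal.ofReal_mul (by positivity), ← ENNReal.ofReal_mul (by positivity)]
      congr 2; field_simp
    rw [h5] at h2
    have h6 := h2.trans (add_le_add_left h4 _)
    have hfin : ENNReal.ofReal w * (ENNReal.ofReal (ρ ^ d / lam) * ωd) ≠ ⊤ :=
      ENNReal.mul_ne_top ENNReal.ofReal_ne_top (ENNReal.mul_ne_top ENNReal.ofReal_ne_top hωdt)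
    have h7 := (ENNReal.add_le_add_iff_left hfin).1 h6
    have e : lam * M ^ d / ρ ^ d = 1 / s := by rw [hsdef]; field_simp
    rw [e]; exact h7
  have h8 := setLIntegral_mono' (μ := volume) measurableSet_ball hz
  have hc0 : ENNReal.ofReal (ρ ^ d / lam) * ωd ≠ 0 :=
    mul_ne_zero (by simp; positivity) hωd0
  have hct : ENNReal.ofReal (ρ ^ d / lam) * ωd ≠ ⊤ := ENNReal.mul_ne_top ENNReal.ofReal_ne_top hωdt
  rw [lintegral_mul_const' _ _ hct, lintegral_const_mul' _ _ ENNReal.ofReal_ne_top,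
    lintegral_lintegral_swap hbm'.aemeasurable] at h8
  have h9 : ∫⁻ y in ball (0 : E d) ρ, ∫⁻ z in ball (0 : E k) r, ENNReal.ofReal (b y z) ≤
      (ENNReal.ofReal (L ^ k) * ωk) * (ENNReal.ofReal (ρ ^ d) * ωd) := by
    rw [← hvol, ← setLIntegral_const]
    exact setLIntegral_mono' measurableSet_ball hb
  have h10 := h8.trans (mul_le_mul_right h9 _)
  have h11 : ENNReal.ofReal (lam * M ^ d / ρ ^ d) * ((ENNReal.ofReal (L ^ k) * ωk) * (ENNReal.ofReal (ρ ^ d) * ωd))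
    = (ENNReal.ofReal (lam ^ 2 * (M / ρ) ^ d * L ^ k) * ωk) * (ENNReal.ofReal (ρ ^ d / lam) * ωd) := by
    have : ENNReal.ofReal (lam * M ^ d / ρ ^ d) * ENNReal.ofReal (L ^ k) * ENNReal.ofReal (ρ ^ d) =
      ENNReal.ofReal (lam ^ 2 * (M / ρ) ^ d * L ^ k) * ENNReal.ofReal (ρ ^ d / lam) := by
      rw [← ENNReal.ofReal_mul (by positivity), ← ENNReal.ofReal_mul (by positivity),
        ← ENNReal.ofReal_mul (by positivity)]
      congr 1; rw [div_pow]; field_simp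
    calc _ = (ENNReal.ofReal (lam * M ^ d / ρ ^ d) * ENNReal.ofReal (L ^ k) * ENNReal.ofReal (ρ ^ d)) * (ωk * ωd) := by ring
      _ = _ := by rw [this]; ring
  rw [h11] at h10
  exact (ENNReal.mul_le_mul_iff_left hc0 hct).1 h10

lemma radial {d k : ℕ} (hk : 1 ≤ k) (γ r B : ℝ) (hγ : 0 < γ) (hr : 0 < r) (hB : 0 ≤ B)
    (h : ∫⁻ z in ball (0 : E k) r, ENNReal.ofReal (1 / (γ + ‖z‖) ^ d) ≤
      ENNReal.ofReal B * volume (ball (0 : E k) 1)) :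
    ∫ t in (0:ℝ)..r, t ^ (k - 1) * (1 / (γ + t) ^ d) ≤ B := by
  have hnt : Nonempty (Fin k) := ⟨⟨0, hk⟩⟩
  have h1 := integral_fun_norm_addHaar (volume : Measure (E k))
    (indicator (Iio r) (fun t => 1 / (γ + t) ^ d))
  have e1 : ∫ x : E k, indicator (Iio r) (fun t => 1 / (γ + t) ^ d) ‖x‖ =
      ∫ z in ball (0 : E k) r, 1 / (γ + ‖z‖) ^ d := by
    rw [← integral_indicator measurableSet_ball]
    congr 1; ext x
    by_cases hx : ‖x‖ < r <;> simp [hx]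
  have e2 : ∫ y in Ioi (0 : ℝ), y ^ (k - 1) • indicator (Iio r) (fun t => 1 / (γ + t) ^ d) y =
      ∫ t in (0:ℝ)..r, t ^ (k - 1) * (1 / (γ + t) ^ d) := by
    rw [intervalIntegral.integral_of_le hr.le, integral_Ioc_eq_integral_Ioo,
      ← integral_indicator measurableSet_Ioi, ← integral_indicator measurableSet_Ioo]
    congr 1; ext x
    by_cases hx : 0 < x <;> by_cases hx' : x < r <;> simp [hx, hx']
  rw [e1, finrank_euclideanSpace_fin, e2] at h1
  have h2 : ∫ z in ball (0 : E k) r, 1 / (γ + ‖z‖) ^ d ≤ B * volume.real (ball (0 : E k) 1) := by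
    rw [integral_eq_lintegral_of_nonneg_ae (Eventually.of_forall fun z => by positivity)
      (Measurable.aestronglyMeasurable (by fun_prop))]
    have := ENNReal.toReal_mono (ENNReal.mul_ne_top ENNReal.ofReal_ne_top measure_ball_lt_top.ne) h
    rwa [ENNReal.toReal_mul, ENNReal.toReal_ofReal hB] at this
  rw [h1] at h2
  have hω : 0 < volume.real (ball (0 : E k) 1) :=
    ENNReal.toReal_pos (measure_ball_pos _ _ one_pos).ne' measure_ball_lt_top.ne
  have hI : 0 ≤ ∫ t in (0:ℝ)..r, t ^ (k - 1) * (1 / (γ + t) ^ d) := by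
    apply intervalIntegral.integral_nonneg hr.le
    intro t ht
    have := ht.1
    positivity
  simp only [nsmul_eq_mul, smul_eq_mul] at h2
  have hk' : (1:ℝ) ≤ k := by exact_mod_cast hk
  have h3 : volume.real (ball (0 : E k) 1) * (∫ t in (0:ℝ)..r, t ^ (k - 1) * (1 / (γ + t) ^ d)) ≤
     B * volume.real (ball (0 : E k) 1) :=
    le_trans (le_mul_of_one_le_left (by positivity) hk') h2
  rw [mul_comm B] at h3
  exact le_of_mul_le_mul_left h3 hω

lemma final_scale {n d : ℕ} (hd : 1 ≤ d) (hdn : d < n) (lam L δ γ ℓ : ℝ)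
    (hlam : 0 < lam) (hL : 0 < L) (hδ : 0 < δ) (hγ : 0 < γ) (hℓ : 0 < ℓ)
    (h : ∫ t in (0:ℝ)..(δ/2), t ^ (n - d - 1) * (1 / (γ + t) ^ d) ≤
      lam ^ 2 * ((2 * L / ℓ) / (ℓ / 2)) ^ d * L ^ (n - d)) :
    ℓ ^ (2 * d) *
          ((δ / γ) ^ (2 * (d : ℤ) - (n : ℤ)) *
            ∫ r in (0 : ℝ)..(δ / γ), r ^ (n - d - 1) / (r + 1) ^ d) ≤
        8 ^ n * lam ^ 2 * L ^ n * δ ^ (2 * (d : ℤ) - (n : ℤ)) := by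
  obtain ⟨k, rfl⟩ : ∃ k, n = d + (k + 1) := ⟨n - d - 1, by omega⟩
  have ek : d + (k + 1) - d = k + 1 := by omega
  rw [ek, Nat.add_sub_cancel] at h ⊢
  set I := ∫ t in (0:ℝ)..(δ/2), t ^ k * (1 / (γ + t) ^ d) with hI
  have h1 : ∫ r in (0 : ℝ)..(δ / γ), r ^ k / (r + 1) ^ d ≤ (2 / γ) ^ (k + 1) * γ ^ d * I := by
    have hc : (2 / γ) ≠ 0 := by positivity
    have e := intervalIntegral.mul_integral_comp_mul_left (a := 0) (b := δ / 2)
      (f := fun r : ℝ => r ^ k / (r + 1) ^ d) (2 / γ)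
    have e' : 2 / γ * (δ / 2) = δ / γ := by field_simp
    rw [mul_zero, e'] at e
    rw [← e, pow_succ', mul_assoc, mul_assoc]
    apply mul_le_mul_of_nonneg_left _ (by positivity)
    rw [hI, ← mul_assoc, ← intervalIntegral.integral_const_mul]
    have hpos : ∀ t ∈ uIcc (0:ℝ) (δ/2), 0 ≤ t := by
      intro t ht
      rw [uIcc_of_le (by positivity)] at ht
      exact ht.1
    apply intervalIntegral.integral_mono_on (by positivity)
    · apply ContinuousOn.intervalIntegrable
      intro t ht
      have := hpos t ht
      apply ContinuousAt.continuousWithinAt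
      have : (2 / γ * t + 1) ^ d ≠ 0 := by positivity
      fun_prop (disch := assumption)
    · apply ContinuousOn.intervalIntegrable
      intro t ht
      have := hpos t ht
      apply ContinuousAt.continuousWithinAt
      have : (γ + t) ^ d ≠ 0 := by positivity
      fun_prop (disch := assumption)
    · intro t ht
      have ht0 := ht.1
      have e1 : (2 / γ) ^ k * γ ^ d * (t ^ k * (1 / (γ + t) ^ d)) =
          (2 / γ * t) ^ k / ((γ + t) / γ) ^ d := by
        rw [mul_pow, div_pow (γ + t)]; field_simp
      rw [e1]
      apply div_le_div_of_nonneg_left (by positivity) (by positivity)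
      apply pow_le_pow_left₀ (by positivity)
      have : 2 / γ * t + 1 - (γ + t) / γ = t / γ := by field_simp; ring
      have : 0 ≤ t / γ := by positivity
      linarith
  have hz : (2 * (d : ℤ) - ((d + (k + 1) : ℕ) : ℤ)) = (d : ℤ) - ((k + 1 : ℕ) : ℤ) := by
    push_cast; ring
  rw [hz, div_zpow]
  have e3 : γ ^ ((d : ℤ) - ((k + 1 : ℕ) : ℤ)) = γ ^ d / γ ^ (k + 1) := by
    rw [zpow_sub₀ hγ.ne', zpow_natCast, zpow_natCast]
  set D := δ ^ ((d : ℤ) - ((k + 1 : ℕ) : ℤ)) with hD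
  have hD0 : 0 < D := by positivity
  rw [e3]
  calc _ ≤ ℓ ^ (2 * d) * (D / (γ ^ d / γ ^ (k + 1)) * ((2 / γ) ^ (k + 1) * γ ^ d *
        (lam ^ 2 * ((2 * L / ℓ) / (ℓ / 2)) ^ d * L ^ (k + 1)))) := by
        gcongr
        refine h1.trans ?_
        gcongr
    _ = (2 ^ (k + 1) * 4 ^ d) * (lam ^ 2 * L ^ (d + (k + 1)) * D) := by
        have : (2 * L / ℓ) / (ℓ / 2) = 4 * L / ℓ ^ 2 := by field_simp; norm_num
        rw [this, div_pow, div_pow, mul_pow, pow_add L d (k + 1), ← pow_mul]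
        field_simp
    _ ≤ 8 ^ (d + (k + 1)) * (lam ^ 2 * L ^ (d + (k + 1)) * D) := by
        gcongr
        rw [pow_add 8 d (k + 1), mul_comm]
        apply mul_le_mul
        · exact pow_le_pow_left₀ (by norm_num) (by norm_num) _
        · exact pow_le_pow_left₀ (by norm_num) (by norm_num) _
        · positivity
        · positivity
    _ = _ := by ring

theorem stmt10 : ∀ n : ℕ, 3 ≤ n → ∃ C : ℝ, 0 < C ∧
    ∀ d : ℕ, 1 ≤ d → d < n →
    ∀ (Ω : Set (E n)), IsOpen Ω →
    ∀ ψ : E n → ℝ, ContDiffOn ℝ 2 ψ Ω → ConvexOn ℝ Ω ψ → (∀ x ∈ Ω, 0 ≤ ψ x) →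
    ∀ lam : ℝ, 0 < lam → (∀ x ∈ Ω, 1 / lam ^ 2 ≤ hessDet ψ x) →
    ∀ x₀ ∈ Ω, ψ x₀ = 0 →
    ∀ δ : ℝ, δ = infDist x₀ (frontier Ω) → 0 < δ →
    ∀ L : ℝ, L = sSup ((fun x => ‖gradient ψ x‖) '' Ω) →
      BddAbove ((fun x => ‖gradient ψ x‖) '' Ω) → 0 < L →
    ∀ V : Submodule ℝ (E n), Module.finrank ℝ V = d →
    ∀ ℓ : ℝ, 0 < ℓ → ℓ ≤ δ / 2 →
    ∀ γ : ℝ, γ = sSup (ψ '' (closedBall x₀ ℓ ∩ ((fun v => x₀ + v) '' (V : Set (E n))))) / L →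
    0 < γ ∧
      ℓ ^ (2 * d) *
          ((δ / γ) ^ (2 * (d : ℤ) - (n : ℤ)) *
            ∫ r in (0 : ℝ)..(δ / γ), r ^ (n - d - 1) / (r + 1) ^ d) ≤
        C * lam ^ 2 * L ^ n * δ ^ (2 * (d : ℤ) - (n : ℤ)) := by
  intro n _
  refine ⟨8 ^ n, by positivity, ?_⟩
  intro d hd hdn Ω hΩ ψ hψ hc hψ0 lam hlam hdet x₀ hx₀ hψx₀ δ hδ hδ0 L hL hLb hL0 V hV ℓ hℓ hℓδ γ hγ
  have hball := ball_sub_omega hx₀ hδ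
  have hca : ∀ y ∈ Ω, ContDiffAt ℝ 2 ψ y := fun y hy => hψ.contDiffAt (hΩ.mem_nhds hy)
  have hda : ∀ y ∈ Ω, DifferentiableAt ℝ ψ y := fun y hy => (hca y hy).differentiableAt (by norm_num)
  have hG : ∀ y ∈ Ω, DifferentiableAt ℝ (gradient ψ) y := fun y hy => grad_diff (hca y hy)
  have hGL : ∀ y ∈ Ω, ‖gradient ψ y‖ ≤ L := fun y hy => hL ▸ le_csSup hLb ⟨y, hy, rfl⟩
  have hT : ∀ y ∈ Ω, 1 / lam ^ 2 ≤ (fderiv ℝ (gradient ψ) y).det := fun y hy =>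
    (hdet y hy).trans_eq (hess_det (hca y hy))
  have hpos : ∀ x ∈ Ω, ∀ v, v ≠ 0 → 0 < ⟪fderiv ℝ (gradient ψ) x v, v⟫ := fun x hx =>
    pos_of_nonneg _ (hess_symm (hca x hx)) (hess_nonneg hΩ hc hψ hx)
      (lt_of_lt_of_le (by positivity) (hT x hx))
  have hlip : ∀ x ∈ Ω, ∀ y ∈ Ω, ψ x ≤ ψ y + L * ‖x - y‖ := by
    intro x hx y hy
    have h1 := grad_ineq hc hx hy (hda x hx)
    have h2 : ⟪gradient ψ x, x - y⟫ ≤ L * ‖x - y‖ :=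
      (real_inner_le_norm _ _).trans (by gcongr; exact hGL x hx)
    have h3 : y - x = -(x - y) := by abel
    rw [h3, inner_neg_right] at h1
    linarith
  -- the isometries
  obtain ⟨k, hk1, hk⟩ : ∃ k, 1 ≤ k ∧ d + k = n := ⟨n - d, by omega, by omega⟩
  have hVo : Module.finrank ℝ Vᗮ = k := by
    have := V.finrank_add_finrank_orthogonal
    rw [hV, finrank_euclideanSpace_fin] at this
    omega
  let bV := (stdOrthonormalBasis ℝ V).reindex (finCongr hV)
  let bW := (stdOrthonormalBasis ℝ Vᗮ).reindex (finCongr hVo)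
  let J : E d →ₗᵢ[ℝ] E n := V.subtypeₗᵢ.comp bV.repr.symm.toLinearIsometry
  let K : E k →ₗᵢ[ℝ] E n := Vᗮ.subtypeₗᵢ.comp bW.repr.symm.toLinearIsometry
  have hJV : ∀ y, J y ∈ V := fun y => (bV.repr.symm y).2
  have hKV : ∀ z, K z ∈ Vᗮ := fun z => (bW.repr.symm z).2
  have hJK : ∀ y z, ⟪J y, K z⟫ = 0 := fun y z =>
    Submodule.inner_right_of_mem_orthogonal (hJV y) (hKV z)
  clear_value J K
  have hmem : ∀ y : E d, ‖y‖ ≤ ℓ → ∀ z : E k, ‖z‖ < δ / 2 → x₀ + J y + K z ∈ Ω := by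
    intro y hy z hz
    apply hball
    rw [mem_ball, dist_eq_norm, add_assoc, add_sub_cancel_left]
    calc ‖J y + K z‖ ≤ ‖J y‖ + ‖K z‖ := norm_add_le _ _
      _ = ‖y‖ + ‖z‖ := by rw [J.norm_map, K.norm_map]
      _ < δ := by linarith
  have hmemJ : ∀ y : E d, ‖y‖ ≤ ℓ → x₀ + J y ∈ Ω := by
    intro y hy
    have := hmem y hy 0 (by simpa using hδ0)
    simpa using this
  -- the supremum
  have hbdd : BddAbove (ψ '' (closedBall x₀ ℓ ∩ ((fun v => x₀ + v) '' (V : Set (E n))))) := by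
    refine ⟨L * ℓ, ?_⟩
    rintro _ ⟨x, ⟨hx, -⟩, rfl⟩
    rw [mem_closedBall, dist_eq_norm] at hx
    have hxΩ : x ∈ Ω := hball (by rw [mem_ball, dist_eq_norm]; linarith)
    have := hlip x hxΩ x₀ hx₀
    rw [hψx₀, zero_add] at this
    exact this.trans (by gcongr)
  have hγL : γ * L = sSup (ψ '' (closedBall x₀ ℓ ∩ ((fun v => x₀ + v) '' (V : Set (E n))))) := by
    rw [hγ]; field_simp
  have hsup : ∀ y : E d, ‖y‖ ≤ ℓ → ψ (x₀ + J y) ≤ γ * L := by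
    intro y hy
    rw [hγL]
    apply le_csSup hbdd
    refine ⟨_, ⟨?_, J y, hJV y, rfl⟩, rfl⟩
    simpa using hy
  -- positivity of γ
  have hγ0 : 0 < γ := by
    by_contra hneg
    have hzero : ∀ y : E d, ‖y‖ ≤ ℓ → ψ (x₀ + J y) = 0 := by
      intro y hy
      have h1 := hsup y hy
      have h2 := hψ0 _ (hmemJ y hy)
      have : γ * L ≤ 0 := mul_nonpos_of_nonpos_of_nonneg (not_lt.1 hneg) hL0.le
      linarith
    have hgz : ∀ y : E d, ‖y‖ ≤ ℓ → gradient ψ (x₀ + J y) = 0 := by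
      intro y hy
      have hmin : IsLocalMin ψ (x₀ + J y) := by
        filter_upwards [hΩ.mem_nhds (hmemJ y hy)] with x hx
        rw [hzero y hy]; exact hψ0 x hx
      simp [gradient, hmin.fderiv_eq_zero]
    have hinj := slice_inj hG hpos J x₀ (convex_closedBall (0 : E d) ℓ)
      (fun y hy => hmemJ y (by simpa using hy))
    let e : E d := EuclideanSpace.single ⟨0, hd⟩ ℓ
    have he : ‖e‖ = ℓ := by simp [e, abs_of_pos hℓ]
    have h0 : e = 0 := by
      apply hinj
      · simp [he]
      · simp [hℓ.le]
      · simp only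
        rw [hgz e he.le, hgz 0 (by simpa using hℓ.le)]
    rw [h0, norm_zero] at he
    exact hℓ.ne he
  refine ⟨hγ0, ?_⟩
  apply final_scale hd hdn lam L δ γ ℓ hlam hL0 hδ0 hγ0 hℓ
  have hnk : n - d = k := by omega
  rw [hnk]
  apply radial hk1 γ (δ / 2) _ hγ0 (by positivity) (by positivity)
  have hTm : Measurable (fderiv ℝ (gradient ψ)) := measurable_fderiv ℝ _
  refine measure_est
    (fun y z => |(J.toContinuousLinearMap.adjoint ∘L fderiv ℝ (gradient ψ) (x₀ + J y + K z) ∘L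
      J.toContinuousLinearMap).det|)
    (fun y z => |(K.toContinuousLinearMap.adjoint ∘L fderiv ℝ (gradient ψ) (x₀ + J y + K z) ∘L
      K.toContinuousLinearMap).det|) ?_ (fun _ _ => abs_nonneg _) (fun _ _ => abs_nonneg _)
    lam (2 * L / ℓ) L γ (ℓ / 2) (δ / 2) hlam (by positivity) hγ0 (by positivity) hL0 ?_ ?_ ?_
  · have hcont : Continuous (fun T : E n →L[ℝ] E n =>
        |(K.toContinuousLinearMap.adjoint ∘L T ∘L K.toContinuousLinearMap).det|) := by
      have h1 : Continuous (fun T : E n →L[ℝ] E n =>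
        (K.toContinuousLinearMap.adjoint ∘L T ∘L K.toContinuousLinearMap)) := by fun_prop
      exact (ContinuousLinearMap.continuous_det.comp h1).abs
    have hpt : Continuous (fun p : E d × E k => x₀ + J p.1 + K p.2) := by
      have := J.continuous
      have := K.continuous
      fun_prop
    exact hcont.measurable.comp (hTm.comp hpt.measurable)
  · intro z hz
    rw [mem_ball_zero_iff] at hz
    have hR : 0 ≤ 2 * L / ℓ * (γ + ‖z‖) := by positivity
    have := slice_bound hG hpos J (x₀ + K z) (ℓ / 2) (2 * L / ℓ * (γ + ‖z‖)) hR ?_ ?_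
    · simpa only [add_right_comm] using this
    · intro y hy
      rw [mem_ball_zero_iff] at hy
      rw [add_right_comm]
      exact hmem y (by linarith) z hz
    · intro y hy
      rw [mem_ball_zero_iff] at hy
      rw [add_right_comm]
      set p := J.toContinuousLinearMap.adjoint (gradient ψ (x₀ + J y + K z)) with hp
      by_cases hp0 : p = 0
      · rw [hp0, norm_zero]; exact hR
      have hpn : 0 < ‖p‖ := norm_pos_iff.2 hp0
      let w : E d := (ℓ / 2 / ‖p‖) • p
      have hw : ‖w‖ = ℓ / 2 := by
        simp only [w, norm_smul, norm_div, Real.norm_eq_abs, abs_of_pos hℓ]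
        simp
        field_simp
      have hyw : ‖y + w‖ ≤ ℓ := (norm_add_le _ _).trans (by linarith)
      have hyl : ‖y‖ ≤ ℓ := by linarith
      have h1 := grad_ineq hc (hmem y hyl z hz) (hmem (y + w) hyw z hz) (hda _ (hmem y hyl z hz))
      have h2 : x₀ + J (y + w) + K z - (x₀ + J y + K z) = J w := by
        rw [map_add]; abel
      have h3 : ⟪gradient ψ (x₀ + J y + K z), J w⟫ = ℓ / 2 * ‖p‖ := by
        have : ⟪gradient ψ (x₀ + J y + K z), J w⟫ = ⟪p, w⟫ := by
          rw [hp, ContinuousLinearMap.adjoint_inner_left]; rfl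
        rw [this]
        simp only [w, inner_smul_right, real_inner_self_eq_norm_sq]
        field_simp
      rw [h2, h3] at h1
      have h4 := hlip _ (hmem (y + w) hyw z hz) _ (hmemJ (y + w) hyw)
      rw [add_sub_cancel_left, K.norm_map] at h4
      have h5 := hsup (y + w) hyw
      have h6 := hψ0 _ (hmem y hyl z hz)
      have h7 : ℓ / 2 * ‖p‖ ≤ L * (γ + ‖z‖) := by linarith
      have e : 2 * L / ℓ * (γ + ‖z‖) = (L * (γ + ‖z‖)) / (ℓ / 2) := by field_simp
      rw [e, le_div_iff₀ (by positivity)]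
      linarith
  · intro y hy
    rw [mem_ball_zero_iff] at hy
    refine slice_bound hG hpos K (x₀ + J y) (δ / 2) L hL0.le ?_ ?_
    · intro z hz
      exact hmem y (by linarith) z (by simpa using hz)
    · intro z hz
      have hm := hmem y (by linarith) z (by simpa using hz)
      calc _ ≤ ‖K.toContinuousLinearMap.adjoint‖ * ‖gradient ψ (x₀ + J y + K z)‖ :=
            ContinuousLinearMap.le_opNorm _ _
        _ ≤ 1 * L := by
          gcongr
          · rw [LinearIsometryEquiv.norm_map]
            exact K.norm_toContinuousLinearMap_le
          · exact hGL _ hm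
        _ = L := one_mul L
  · intro y hy z hz
    rw [mem_ball_zero_iff] at hy hz
    have hm := hmem y (by linarith) z hz
    have h1 := fischer_geom hk hd _ (hess_symm (hca _ hm)) (hpos _ hm) J K hJK
    rw [← abs_mul]
    exact (hT _ hm).trans (h1.trans (le_abs_self _))
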